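/- Let K be a compact subset of ℝⁿ, let σ : ℝ → ℝ be a continuous, bounded, and non-constant function, and let f : ℝⁿ → ℝ be continuous on K. Then for every ε > 0 there exist a natural number N, coefficients a₁, …, a_N ∈ ℝ, weight vectors w₁, …, w_N ∈ ℝⁿ, and biases b₁, …, b_N ∈ ℝ such that for all x ∈ K, |f(x) − ∑_{i=1}^{N} aᵢ · σ(⟨wᵢ, x⟩ + bᵢ)| < ε. -/

import Mathlib

open scoped RealInnerProductSpace

open MeasureTheory Filter Topology Convolution Polynomial ContDiff

/-- The Bochner integral of a function with values in a closed subspace lies in that subspace. -/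
theorem Submodule.integral_mem_of_isClosed {α E : Type*} [MeasurableSpace α] {μ : Measure α}
    [NormedAddCommGroup E] [NormedSpace ℝ E] [CompleteSpace E] {M : Submodule ℝ E}
    (hM : IsClosed (M : Set E)) {F : α → E} (hF : Integrable F μ) (h : ∀ x, F x ∈ M) :
    ∫ x, F x ∂μ ∈ M := by
  have : IsClosed (M : Set E) := hM
  have h0 : M.mkQL (∫ x, F x ∂μ) = 0 := by
    rw [← ContinuousLinearMap.integral_comp_comm _ hF]
    refine integral_eq_zero_of_ae (Eventually.of_forall fun x => ?_)
    simpa using h x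
  simpa using h0

/-- The derivative of a curve in a closed subspace lies in that subspace. -/
theorem HasDerivAt.mem_of_isClosed {E : Type*} [NormedAddCommGroup E] [NormedSpace ℝ E]
    {M : Submodule ℝ E} (hM : IsClosed (M : Set E)) {F : ℝ → E} {F' : E} {a : ℝ}
    (hF : HasDerivAt F F' a) (h : ∀ x, F x ∈ M) : F' ∈ M := by
  rw [hasDerivAt_iff_tendsto_slope] at hF
  refine hM.mem_of_tendsto hF (Eventually.of_forall fun x => ?_)
  exact M.smul_mem _ (M.sub_mem (h x) (h a))

theorem Polynomial.exists_derivative_eq (q : ℝ[X]) : ∃ p : ℝ[X], derivative p = q := by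
  induction q using Polynomial.induction_on' with
  | add p q hp hq =>
    obtain ⟨p', rfl⟩ := hp
    obtain ⟨q', rfl⟩ := hq
    exact ⟨p' + q', derivative_add⟩
  | monomial n a =>
    refine ⟨monomial (n + 1) (a / (n + 1)), ?_⟩
    rw [derivative_monomial]
    have : (n : ℝ) + 1 ≠ 0 := by positivity
    simp [div_mul_cancel₀ _ this]

/-- A smooth function with an identically vanishing iterated derivative is a polynomial. -/
theorem exists_polynomial_of_iteratedDeriv_eq_zero (k : ℕ) {s : ℝ → ℝ} (hs : ContDiff ℝ ∞ s)
    (h : ∀ x, iteratedDeriv k s x = 0) : ∃ p : ℝ[X], ∀ x, s x = p.eval x := by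
  induction k generalizing s with
  | zero => exact ⟨0, by simpa using h⟩
  | succ k ih =>
    have hds : ContDiff ℝ ∞ (deriv s) := (contDiff_infty_iff_deriv.1 hs).2
    obtain ⟨q, hq⟩ := ih hds (by simpa [iteratedDeriv_succ'] using h)
    obtain ⟨p, rfl⟩ := q.exists_derivative_eq
    have hsd : Differentiable ℝ s := (contDiff_infty_iff_deriv.1 hs).1
    have hconst := is_const_of_deriv_eq_zero (f := fun x => s x - p.eval x)
      (hsd.sub p.differentiable) (fun x => by
        rw [deriv_fun_sub (hsd x) p.differentiableAt, hq, Polynomial.deriv, sub_self])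
    refine ⟨p + C (s 0 - p.eval 0), fun x => ?_⟩
    have := hconst x 0
    simp only [eval_add, eval_C]
    linarith

/-- No iterated derivative of a smooth, bounded, non-constant function vanishes identically. -/
theorem exists_iteratedDeriv_ne_zero {s : ℝ → ℝ} (hs : ContDiff ℝ ∞ s)
    {B : ℝ} (hB : ∀ t, |s t| ≤ B) (hne : ¬ ∃ c, ∀ t, s t = c) (k : ℕ) :
    ∃ b, iteratedDeriv k s b ≠ 0 := by
  by_contra! h
  obtain ⟨p, hp⟩ := exists_polynomial_of_iteratedDeriv_eq_zero k hs h
  have hdeg : p.degree ≤ 0 := p.isBoundedUnder_abs_atTop_iff.1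
    ⟨B, eventually_map.2 (Eventually.of_forall fun x => by rw [← hp]; exact hB x)⟩
  rw [eq_C_of_degree_le_zero hdeg] at hp
  exact hne ⟨p.coeff 0, by simpa using hp⟩

/-- Mollification of a continuous, bounded, non-constant function. -/
theorem exists_bump_convolution {σ : ℝ → ℝ} (hσ : Continuous σ) {B : ℝ} (hB : ∀ t, |σ t| ≤ B)
    (hne : ¬ ∃ c, ∀ t, σ t = c) :
    ∃ φ : ℝ → ℝ, Continuous φ ∧ HasCompactSupport φ ∧
      ContDiff ℝ ∞ (fun x => ∫ t, φ t * σ (x - t)) ∧ (∀ x, |∫ t, φ t * σ (x - t)| ≤ B) ∧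
      ¬ ∃ c, ∀ x, ∫ t, φ t * σ (x - t) = c := by
  obtain ⟨x, y, hxy⟩ : ∃ x y, σ x ≠ σ y := by
    by_contra! h
    exact hne ⟨σ 0, fun t => h t 0⟩
  let φ : ℕ → ContDiffBump (0 : ℝ) := fun n =>
    ⟨1 / (n + 1) / 2, 1 / (n + 1), by positivity, half_lt_self (by positivity)⟩
  have hφ : Tendsto (fun n => (φ n).rOut) atTop (𝓝 0) := tendsto_one_div_add_atTop_nhds_zero_nat
  have hx := ContDiffBump.convolution_tendsto_right_of_continuous (μ := volume) hφ hσ x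
  have hy := ContDiffBump.convolution_tendsto_right_of_continuous (μ := volume) hφ hσ y
  obtain ⟨n, hn⟩ := ((hx.sub hy).eventually_ne (sub_ne_zero.2 hxy)).exists
  have hcont : Continuous ((φ n).normed volume) := (φ n).continuous_normed
  have hsupp : HasCompactSupport ((φ n).normed volume) := (φ n).hasCompactSupport_normed
  refine ⟨(φ n).normed volume, hcont, hsupp, ?_, fun z => ?_, ?_⟩
  · exact hsupp.contDiff_convolution_left (ContinuousLinearMap.lsmul ℝ ℝ) (n := ⊤)
      (φ n).contDiff_normed hσ.locallyIntegrable
  · have hint := hcont.integrable_of_hasCompactSupport (μ := volume) hsupp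
    calc |∫ t, (φ n).normed volume t * σ (z - t)|
        ≤ ∫ t, (φ n).normed volume t * B := by
          refine norm_integral_le_of_norm_le (f := fun t => (φ n).normed volume t * σ (z - t))
            (hint.mul_const B) (Eventually.of_forall fun t => ?_)
          rw [norm_mul, Real.norm_of_nonneg ((φ n).nonneg_normed t)]
          exact mul_le_mul_of_nonneg_left (hB _) ((φ n).nonneg_normed t)
      _ = B := by rw [integral_mul_const, (φ n).integral_normed, one_mul]
  · rintro ⟨c, hc⟩
    refine hn (sub_eq_zero.2 ?_)
    exact (hc x).trans (hc y).symm

section ClosedSubspace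

variable {X : Type*} [TopologicalSpace X] [CompactSpace X] {M : Submodule ℝ C(X, ℝ)}

theorem ContinuousMap.mollify_comp_mem (hM : IsClosed (M : Set C(X, ℝ))) {σ φ : ℝ → ℝ}
    (hσ : Continuous σ) (hφ : Continuous φ) (hφs : HasCompactSupport φ) {g : C(X, ℝ)}
    (h : ∀ b, (⟨fun x => σ (g x + b), by fun_prop⟩ : C(X, ℝ)) ∈ M)
    (hs : Continuous fun x => ∫ t, φ t * σ (x - t)) :
    (⟨fun x => ∫ t, φ t * σ (g x - t), hs.comp g.continuous⟩ : C(X, ℝ)) ∈ M := by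
  let G : C(ℝ × X, ℝ) := ⟨fun p => σ (g p.2 + -p.1), by fun_prop⟩
  have hint : Integrable (fun t => φ t • G.curry t) :=
    (hφ.smul G.curry.continuous).integrable_of_hasCompactSupport hφs.smul_right
  have hmem := Submodule.integral_mem_of_isClosed hM hint fun t => M.smul_mem _ (h (-t))
  convert hmem using 1
  ext x
  rw [ContinuousMap.integral_apply hint]
  simp [G, sub_eq_add_neg]

theorem ContinuousMap.pow_mul_iteratedDeriv_comp_mem (hM : IsClosed (M : Set C(X, ℝ)))
    {s : ℝ → ℝ} (hs : ContDiff ℝ ∞ s) (L : C(X, ℝ))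
    (h : ∀ a b : ℝ, (⟨fun x => s (a * L x + b), by have := hs.continuous; fun_prop⟩ : C(X, ℝ)) ∈ M)
    (k : ℕ) (a b : ℝ) (hk : Continuous (iteratedDeriv k s)) :
    (⟨fun x => L x ^ k * iteratedDeriv k s (a * L x + b), by fun_prop⟩ : C(X, ℝ)) ∈ M := by
  induction k generalizing a b with
  | zero => simpa using h a b
  | succ k ih =>
    have hk' : Continuous (iteratedDeriv k s) := hs.continuous_iteratedDeriv k (by exact_mod_cast le_top)
    have hd : Differentiable ℝ (iteratedDeriv k s) :=
      hs.differentiable_iteratedDeriv k (by exact_mod_cast WithTop.coe_lt_top k)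
    let F : ℝ → C(X, ℝ) := fun a =>
      ⟨fun x => L x ^ k * iteratedDeriv k s (a * L x + b), by fun_prop⟩
    let G : C(ℝ × X, ℝ) :=
      ⟨fun p => L p.2 ^ (k + 1) * iteratedDeriv (k + 1) s (p.1 * L p.2 + b), by fun_prop⟩
    have hFG : ∀ c, F c = F a + ∫ t in a..c, G.curry t := by
      intro c
      ext x
      have hint : IntervalIntegrable (fun t => G.curry t) volume a c :=
        G.curry.continuous.intervalIntegrable _ _
      have heval : (∫ t in a..c, G.curry t) x = ∫ t in a..c, G (t, x) :=
        ((ContinuousMap.evalCLM ℝ x).intervalIntegral_comp_comm hint).symm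
      have hderiv : ∀ t, HasDerivAt (fun t => F t x) (G (t, x)) t := by
        intro t
        have h1 : HasDerivAt (iteratedDeriv k s) (iteratedDeriv (k + 1) s (t * L x + b))
            (t * L x + b) := by
          rw [iteratedDeriv_succ]
          exact (hd _).hasDerivAt
        have h2 : HasDerivAt (fun t => t * L x + b) (L x) t := by
          simpa using ((hasDerivAt_id t).mul_const (L x)).add_const b
        refine ((h1.comp t h2).const_mul (L x ^ k)).congr_deriv ?_
        simp only [G, ContinuousMap.coe_mk]
        ring
      rw [ContinuousMap.add_apply, heval,
        intervalIntegral.integral_eq_sub_of_hasDerivAt (fun t _ => hderiv t)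
          (Continuous.intervalIntegrable (by fun_prop) _ _)]
      ring
    have hF : HasDerivAt F (G.curry a) a := by
      rw [funext hFG]
      exact (intervalIntegral.integral_hasDerivAt_right
        (G.curry.continuous.intervalIntegrable _ _)
        (G.curry.continuous.stronglyMeasurableAtFilter _ _)
        G.curry.continuous.continuousAt).const_add _
    exact hF.mem_of_isClosed hM fun c => ih c b hk'

/-- A closed subspace of `C(X, ℝ)` containing all `σ ∘ (a L + b)` contains the powers of `L`. -/
theorem ContinuousMap.pow_mem_of_activation_mem (hM : IsClosed (M : Set C(X, ℝ))) {σ : ℝ → ℝ}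
    (hσ : Continuous σ) {B : ℝ} (hB : ∀ t, |σ t| ≤ B) (hne : ¬ ∃ c, ∀ t, σ t = c) (L : C(X, ℝ))
    (h : ∀ a b : ℝ, (⟨fun x => σ (a * L x + b), by fun_prop⟩ : C(X, ℝ)) ∈ M) (k : ℕ) :
    L ^ k ∈ M := by
  obtain ⟨φ, hφ, hφs, hs, hsB, hsne⟩ := exists_bump_convolution hσ hB hne
  obtain ⟨b, hb⟩ := exists_iteratedDeriv_ne_zero hs hsB hsne k
  have hmem := ContinuousMap.pow_mul_iteratedDeriv_comp_mem hM hs L (fun a b =>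
    ContinuousMap.mollify_comp_mem hM hσ hφ hφs (g := ⟨fun x => a * L x + b, by fun_prop⟩)
      (fun c => by simpa [add_assoc] using h a (b + c)) hs.continuous)
    k 0 b (hs.continuous_iteratedDeriv k (by exact_mod_cast le_top))
  convert M.smul_mem (iteratedDeriv k (fun x => ∫ t, φ t * σ (x - t)) b)⁻¹ hmem using 1
  ext x
  simp
  field_simp

theorem ContinuousMap.exp_mem_of_pow_mem (hM : IsClosed (M : Set C(X, ℝ))) (L : C(X, ℝ))
    (h : ∀ k : ℕ, L ^ k ∈ M) : NormedSpace.exp L ∈ M :=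
  hM.mem_of_tendsto (NormedSpace.exp_series_hasSum_exp' (𝕂 := ℝ) L)
    (Eventually.of_forall fun _ => M.sum_mem fun k _ => M.smul_mem _ (h k))

/-- A closed subspace containing the exponentials of a point-separating additive family is dense. -/
theorem ContinuousMap.eq_top_of_exp_mem (hM : IsClosed (M : Set C(X, ℝ))) {E : Type*}
    [AddCommGroup E] (L : E →+ C(X, ℝ)) (hL : ∀ x y, x ≠ y → ∃ v, L v x ≠ L v y)
    (h : ∀ v, NormedSpace.exp (L v) ∈ M) : M = ⊤ := by
  let S : Submonoid C(X, ℝ) :=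
    { carrier := Set.range fun v => NormedSpace.exp (L v)
      one_mem' := ⟨0, by simp⟩
      mul_mem' := by
        rintro _ _ ⟨v, rfl⟩ ⟨w, rfl⟩
        exact ⟨v + w, by simp [NormedSpace.exp_add]⟩ }
  let A : Subalgebra ℝ C(X, ℝ) := Algebra.adjoin ℝ S
  have hAM : (A : Set C(X, ℝ)) ⊆ M := by
    have hle : Subalgebra.toSubmodule A ≤ M := by
      rw [Algebra.adjoin_eq_span, Submonoid.closure_eq, Submodule.span_le]
      rintro _ ⟨v, rfl⟩
      exact h v
    exact hle
  have hsep : A.SeparatesPoints := by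
    intro x y hxy
    obtain ⟨v, hv⟩ := hL x y hxy
    refine ⟨_, ⟨_, Algebra.subset_adjoin ⟨v, rfl⟩, rfl⟩, fun heq => hv (Real.exp_injective ?_)⟩
    have hexp : ∀ z, NormedSpace.exp (L v) z = Real.exp (L v z) := fun z => by
      rw [Real.exp_eq_exp_ℝ]
      exact NormedSpace.map_exp (ContinuousMap.evalAlgHom ℝ ℝ z) 
        (ContinuousMap.evalCLM ℝ z).continuous (L v)
    simpa [hexp] using heq
  have htop := ContinuousMap.subalgebra_topologicalClosure_eq_top_of_separatesPoints A hsep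
  refine eq_top_iff.2 fun g _ => closure_minimal hAM hM ?_
  have hg : g ∈ A.topologicalClosure := htop ▸ Algebra.mem_top
  exact hg

end ClosedSubspace

/-- Universal Approximation Theorem: a single-hidden-layer network with a
continuous, bounded, non-constant activation can uniformly approximate any
continuous function on a compact subset of ℝⁿ. -/
theorem universal_approximation
    (n : ℕ) (K : Set (EuclideanSpace ℝ (Fin n))) (hK : IsCompact K)
    (σ : ℝ → ℝ) (hσ_cont : Continuous σ)
    (hσ_bdd : ∃ C : ℝ, ∀ t : ℝ, |σ t| ≤ C)
    (hσ_nonconst : ¬ ∃ c : ℝ, ∀ t : ℝ, σ t = c)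
    (f : EuclideanSpace ℝ (Fin n) → ℝ) (hf : ContinuousOn f K) :
    ∀ ε > (0 : ℝ), ∃ (N : ℕ) (a : Fin N → ℝ)
      (w : Fin N → EuclideanSpace ℝ (Fin n)) (b : Fin N → ℝ),
      ∀ x ∈ K, |f x - ∑ i : Fin N, a i * σ (⟪w i, x⟫ + b i)| < ε := by
  intro ε hε
  have : CompactSpace K := isCompact_iff_compactSpace.1 hK
  obtain ⟨B, hB⟩ := hσ_bdd
  let r : EuclideanSpace ℝ (Fin n) × ℝ → C(K, ℝ) := fun p =>
    ⟨fun x => σ (⟪p.1, (x : EuclideanSpace ℝ (Fin n))⟫ + p.2), by fun_prop⟩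
  let L : EuclideanSpace ℝ (Fin n) →+ C(K, ℝ) :=
    { toFun := fun v => ⟨fun x => ⟪v, (x : EuclideanSpace ℝ (Fin n))⟫, by fun_prop⟩
      map_zero' := by ext x; simp
      map_add' := fun v w => by ext x; simp [inner_add_left] }
  let M := (Submodule.span ℝ (Set.range r)).topologicalClosure
  have hM : IsClosed (M : Set C(K, ℝ)) := Submodule.isClosed_topologicalClosure _
  have hMtop : M = ⊤ := by
    refine ContinuousMap.eq_top_of_exp_mem hM L (fun x y hxy => ?_) fun v =>
      ContinuousMap.exp_mem_of_pow_mem hM _ <|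
        ContinuousMap.pow_mem_of_activation_mem hM hσ_cont hB hσ_nonconst _ fun a b => ?_
    · by_contra! h
      exact hxy (Subtype.ext (ext_inner_left ℝ h))
    · refine Submodule.le_topologicalClosure _ (Submodule.subset_span ⟨(a • v, b), ?_⟩)
      ext x
      simp [r, L, real_inner_smul_left]
  let f' : C(K, ℝ) := ⟨fun x => f x, hf.domRestrict⟩
  have hf' : f' ∈ closure (Submodule.span ℝ (Set.range r) : Set C(K, ℝ)) := by
    have hfM : f' ∈ M := hMtop ▸ Submodule.mem_top
    exact hfM
  obtain ⟨g, hg, hfg⟩ := Metric.mem_closure_iff.1 hf' ε hε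
  obtain ⟨N, a, p, rfl⟩ := Submodule.mem_span_set'.1 hg
  choose q hq using fun i => (p i).2
  refine ⟨N, a, fun i => (q i).1, fun i => (q i).2, fun x hx => ?_⟩
  have hdist := (ContinuousMap.dist_apply_le_dist (f := f') (⟨x, hx⟩ : K)).trans_lt hfg
  have hfx : f' ⟨x, hx⟩ = f x := rfl
  simpa [Real.dist_eq, hfx, ← hq, r, ContinuousMap.sum_apply] using hdist
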